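/- arXiv:1811.02452 — 2 statements merged into one kernel-verified Lean document; each statement's English description precedes it below -/
import Mathlib

section
/- Let p be a prime, k ≥ 1, q = p^k, let χ be a primitive Dirichlet character modulo q, let ψ₀ be the trivial Dirichlet character modulo q (so ψ₀(x) = 1 if x is a unit and 0 otherwise), and let m₁, m₂, m₃, r be powers of p (nonnegative integer exponents). Then Ĥ(ψ₀, χ, m₁, m₂, m₃, r) = ψ₀(r)·R_q(m₁)·R_q(m₂)·R_q(m₃) + q·R_q(r)·χ(−1)·ψ₀(m₁·m₂·m₃). -/
/-- e_q(x) = exp(2πi x / q). -/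
noncomputable def eN (q : ℕ) (x : ℤ) : ℂ :=
  Complex.exp (2 * Real.pi * Complex.I * x / q)

/-- Ĥ(ψ,χ,m₁,m₂,m₃,r) = ∑_{t,u,v ∈ ℤ/qℤ} χ(t+m₂u)·conj(χ)(rt+m₁m₂)·conj(χ)(u)·
χ(−m₁+ru)·e_q(m₃·(vt)̃)·conj(ψ)(v). -/
noncomputable def Hhat {q : ℕ} [NeZero q] (ψ χ : DirichletCharacter ℂ q)
    (m₁ m₂ m₃ r : ℤ) : ℂ :=
  ∑ t : ZMod q, ∑ u : ZMod q, ∑ v : ZMod q,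
    χ (t + (m₂ : ZMod q) * u) * (starRingEnd ℂ) (χ ((r : ZMod q) * t + ((m₁ * m₂ : ℤ) : ZMod q))) *
      (starRingEnd ℂ) (χ u) * χ (-(m₁ : ZMod q) + (r : ZMod q) * u) *
      eN q (m₃ * (((v * t)).val : ℤ)) * (starRingEnd ℂ) (ψ v)

/-- The Ramanujan sum R_q(n) = ∑_{y ∈ (ℤ/qℤ)ˣ} e_q(n·ỹ). -/
noncomputable def ramanujanSum (q : ℕ) [NeZero q] (n : ℤ) : ℂ :=
  ∑ y : (ZMod q)ˣ, eN q (n * (((y : ZMod q)).val : ℤ))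

open Finset

/-- The Ramanujan sum as a function on `ZMod q`. -/
noncomputable def RR {q : ℕ} [NeZero q] (n : ZMod q) : ℂ :=
  ∑ y : (ZMod q)ˣ, ZMod.stdAddChar (n * (y : ZMod q))

lemma eN_eq {q : ℕ} [NeZero q] (m : ℤ) (x : ZMod q) :
    eN q (m * (x.val : ℤ)) = ZMod.stdAddChar ((m : ZMod q) * x) := by
  have h : ((m : ZMod q) * x) = ((m * (x.val : ℤ) : ℤ) : ZMod q) := by
    simp
  rw [h, ZMod.stdAddChar_coe, eN]

lemma ramanujanSum_eq {q : ℕ} [NeZero q] (m : ℤ) : ramanujanSum q m = RR (m : ZMod q) := by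
  simp only [ramanujanSum, RR, eN_eq]

lemma RR_mul_unit {q : ℕ} [NeZero q] (n : ZMod q) (u : (ZMod q)ˣ) :
    RR (n * (u : ZMod q)) = RR n := by
  unfold RR
  refine Fintype.sum_equiv (Equiv.mulLeft u) _ _ fun y => ?_
  simp [mul_assoc]

lemma RR_mul_isUnit {q : ℕ} [NeZero q] (n : ZMod q) {a : ZMod q} (ha : IsUnit a) :
    RR (n * a) = RR n := by
  obtain ⟨u, rfl⟩ := ha
  exact RR_mul_unit n u

lemma RR_neg {q : ℕ} [NeZero q] (n : ZMod q) : RR (-n) = RR n := by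
  have := RR_mul_unit n (-1)
  simpa using this

/-- Passing from all residues to units. -/
lemma sum_to_units {q : ℕ} [NeZero q] (f : ZMod q → ℂ) (hf : ∀ x, ¬ IsUnit x → f x = 0) :
    ∑ x, f x = ∑ u : (ZMod q)ˣ, f u := by
  classical
  symm
  refine Finset.sum_of_injOn (fun u : (ZMod q)ˣ => (u : ZMod q)) ?_ ?_ ?_ ?_
  · exact fun a _ b _ h => Units.ext h
  · simp
  · intro x _ hx
    apply hf
    rintro ⟨u, rfl⟩
    exact hx ⟨u, by simp, rfl⟩
  · simp

lemma prim_inv {q : ℕ} {χ : DirichletCharacter ℂ q} (hχ : χ.IsPrimitive) :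
    (χ⁻¹).IsPrimitive := by
  rw [DirichletCharacter.isPrimitive_def, DirichletCharacter.conductor_inv]; exact hχ

lemma char_gauss {q : ℕ} [NeZero q] {χ : DirichletCharacter ℂ q} (hχ : χ.IsPrimitive)
    (a : ZMod q) :
    ∑ x, χ x * ZMod.stdAddChar (a * x) = χ⁻¹ a * gaussSum χ ZMod.stdAddChar := by
  rw [← gaussSum_mulShift_of_isPrimitive _ hχ a]
  simp [gaussSum, AddChar.mulShift_apply]

lemma gauss_mul {q : ℕ} [NeZero q] {χ : DirichletCharacter ℂ q} (hχ : χ.IsPrimitive) :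
    χ (-1) * (gaussSum χ ZMod.stdAddChar * gaussSum χ⁻¹ ZMod.stdAddChar) = q := by
  have key : ∑ a : ZMod q, ∑ x : ZMod q,
      χ x * ZMod.stdAddChar (a * x) * ZMod.stdAddChar (-1 * a) = q := by
    rw [Finset.sum_comm]
    have : ∀ x : ZMod q, ∑ a : ZMod q, χ x * ZMod.stdAddChar (a * x) * ZMod.stdAddChar (-1 * a)
        = χ x * (if x - 1 = 0 then (q : ℂ) else 0) := by
      intro x
      have h := AddChar.sum_mulShift (x - 1) (ZMod.isPrimitive_stdAddChar q)
      rw [ZMod.card] at h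
      push_cast at h
      rw [← h, Finset.mul_sum]
      refine Finset.sum_congr rfl fun a _ => ?_
      rw [mul_assoc, ← AddChar.map_add_eq_mul]
      congr 2; ring
    simp only [this, sub_eq_zero]
    simp
  rw [← key]
  simp only [← Finset.sum_mul, char_gauss hχ]
  have := char_gauss (prim_inv hχ) (-1)
  rw [inv_inv] at this
  calc _ = (χ (-1) * gaussSum χ⁻¹ ZMod.stdAddChar) * gaussSum χ ZMod.stdAddChar := by ring
    _ = _ := by
      rw [← this, Finset.sum_mul]
      exact Finset.sum_congr rfl fun a _ => by ring

/-- Lemma A. -/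
lemma sum_units_char {q : ℕ} [NeZero q] {χ : DirichletCharacter ℂ q} (hχ : χ.IsPrimitive)
    (m : ZMod q) : ∑ z : (ZMod q)ˣ, χ (1 - m * z) = RR m := by
  have hq : (q : ℂ) ≠ 0 := by exact_mod_cast NeZero.ne q
  have h0 : gaussSum χ⁻¹ ZMod.stdAddChar ≠ 0 := by
    intro h
    have := gauss_mul hχ
    rw [h] at this
    simp at this
    exact hq this.symm
  apply mul_right_cancel₀ h0
  have hc : ∀ a, χ a * gaussSum χ⁻¹ ZMod.stdAddChar =
      ∑ x, χ⁻¹ x * ZMod.stdAddChar (a * x) := fun a => by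
    rw [char_gauss (prim_inv hχ) a, inv_inv]
  rw [Finset.sum_mul]
  simp only [hc]
  rw [Finset.sum_comm, gaussSum, Finset.mul_sum]
  refine Finset.sum_congr rfl fun x _ => ?_
  by_cases hx : IsUnit x
  · rw [← RR_neg, ← RR_mul_isUnit (-m) hx, RR, Finset.sum_mul]
    refine Finset.sum_congr rfl fun y _ => ?_
    rw [mul_left_comm, ← AddChar.map_add_eq_mul]
    congr 2; ring
  · simp [MulChar.map_nonunit _ hx]

/-- Lemma B. -/
lemma sum_char_RR {q : ℕ} [NeZero q] {χ : DirichletCharacter ℂ q} (hχ : χ.IsPrimitive)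
    (m c : ZMod q) : ∑ b : ZMod q, χ⁻¹ b * RR (m * (c + b)) =
      q * (1 : DirichletCharacter ℂ q) m * χ⁻¹ (-c) := by
  have h1 : ∀ y : (ZMod q)ˣ, ∑ b : ZMod q, χ⁻¹ b * ZMod.stdAddChar (m * (c + b) * (y : ZMod q))
      = χ m * gaussSum χ⁻¹ ZMod.stdAddChar * (χ y * ZMod.stdAddChar ((m * c) * (y : ZMod q))) := by
    intro y
    have := char_gauss (prim_inv hχ) (m * (y : ZMod q))
    rw [inv_inv, map_mul] at this
    calc _ = (∑ x, χ⁻¹ x * ZMod.stdAddChar (m * (y : ZMod q) * x)) *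
          ZMod.stdAddChar ((m * c) * (y : ZMod q)) := by
          rw [Finset.sum_mul]
          refine Finset.sum_congr rfl fun b _ => ?_
          rw [mul_assoc (χ⁻¹ b), ← AddChar.map_add_eq_mul]
          congr 2; ring
      _ = _ := by rw [this]; ring
  simp only [RR, Finset.mul_sum]
  rw [Finset.sum_comm]
  simp only [h1]
  rw [← Finset.mul_sum, ← sum_to_units (fun y => χ y * ZMod.stdAddChar (m * c * y))
    (fun x hx => by simp [MulChar.map_nonunit _ hx]), char_gauss hχ, ← gauss_mul hχ, map_mul]
  have hm : χ m * χ⁻¹ m = (1 : DirichletCharacter ℂ q) m := by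
    rw [← MulChar.mul_apply, mul_inv_cancel]
  have hneg : χ⁻¹ (-c) = χ⁻¹ (-1) * χ⁻¹ c := by rw [← map_mul]; simp
  have h11 : χ (-1) * χ⁻¹ (-1) = 1 := by
    rw [← MulChar.mul_apply, mul_inv_cancel, MulChar.one_apply (IsUnit.neg isUnit_one)]
  rw [hneg, ← hm]
  linear_combination (-(χ m * χ⁻¹ m * χ⁻¹ c * gaussSum χ ZMod.stdAddChar *
    gaussSum χ⁻¹ ZMod.stdAddChar)) * h11

lemma char_mul_inv {q : ℕ} (χ : DirichletCharacter ℂ q) {a : ZMod q} (ha : IsUnit a) :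
    χ a * χ⁻¹ a = 1 := by
  rw [← MulChar.mul_apply, mul_inv_cancel, MulChar.one_apply ha]

/-- The reduced form of `Hhat`. -/
lemma Hhat_reduced {q : ℕ} [NeZero q] (χ : DirichletCharacter ℂ q) (m₁ m₂ m₃ r : ℤ) :
    Hhat 1 χ m₁ m₂ m₃ r = ∑ w : (ZMod q)ˣ, ∑ z : (ZMod q)ˣ,
      χ ((r : ZMod q) - m₁ * w) * χ⁻¹ ((r : ZMod q) - m₂ * z) *
        RR ((m₃ : ZMod q) * ((r : ZMod q) - (m₁ : ZMod q) * (w : ZMod q) -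
          (m₂ : ZMod q) * (z : ZMod q))) := by
  unfold Hhat
  rw [Finset.sum_comm]
  have conj_eq : ∀ (ψ : DirichletCharacter ℂ q) a, (starRingEnd ℂ) (ψ a) = ψ⁻¹ a :=
    fun ψ a => MulChar.star_apply' ψ a
  simp only [conj_eq, eN_eq, inv_one]
  -- the sum over `v`
  have hv : ∀ (C : ℂ) (t : ZMod q), ∑ v : ZMod q, C * ZMod.stdAddChar ((m₃ : ZMod q) * (v * t)) *
      (1 : DirichletCharacter ℂ q) v = C * RR ((m₃ : ZMod q) * t) := by
    intro C t
    rw [sum_to_units _ (fun x hx => by simp [MulChar.map_nonunit _ hx]), RR, Finset.mul_sum]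
    refine Finset.sum_congr rfl fun y _ => ?_
    rw [MulChar.one_apply y.isUnit, mul_one]
    congr 2; ring
  simp only [hv]
  rw [sum_to_units _ (fun x hx => by simp [MulChar.map_nonunit _ hx])]
  refine Fintype.sum_equiv (Equiv.inv (ZMod q)ˣ) _ _ fun u => ?_
  simp only [Equiv.inv_apply]
  by_cases hs : IsUnit ((r : ZMod q) - m₁ * (u⁻¹ : (ZMod q)ˣ))
  swap
  · have h2 : ¬ IsUnit (-(m₁ : ZMod q) + r * u) := by
      intro h
      apply hs
      have := h.mul (u⁻¹).isUnit
      convert this using 1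
      linear_combination (-(r : ZMod q)) * u.mul_inv
    simp [MulChar.map_nonunit _ hs, MulChar.map_nonunit _ h2]
  obtain ⟨s, hs⟩ := hs
  -- substitute `t = u (x - m₂)`
  have e1 : ∑ t : ZMod q, χ (t + m₂ * u) * χ⁻¹ (r * t + ((m₁ * m₂ : ℤ) : ZMod q)) * χ⁻¹ (u : ZMod q) *
      χ (-(m₁ : ZMod q) + r * u) * RR ((m₃ : ZMod q) * t) =
      ∑ x : ZMod q, χ (u * x) * χ⁻¹ (u * (r * x - m₂ * s)) * χ⁻¹ (u : ZMod q) *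
      χ (u * s) * RR ((m₃ : ZMod q) * ((u : ZMod q) * (x - (m₂ : ZMod q)))) := by
    symm
    refine Fintype.sum_equiv ((Equiv.subRight (m₂ : ZMod q)).trans (Units.mulLeft u)) _ _ fun x => ?_
    have a1 : (u : ZMod q) * (x - m₂) + m₂ * u = u * x := by ring
    have a2 : (r : ZMod q) * (u * (x - m₂)) + ((m₁ * m₂ : ℤ) : ZMod q) = u * (r * x - m₂ * s) := by
      rw [hs]; push_cast
      linear_combination (-(m₁ : ZMod q) * m₂) * u.mul_inv
    have a3 : -(m₁ : ZMod q) + r * u = u * s := by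
      rw [hs]
      linear_combination ((m₁ : ZMod q)) * u.mul_inv
    simp only [Equiv.trans_apply, Equiv.subRight_apply, Units.mulLeft_apply, a1, a2, a3]
  rw [e1, sum_to_units _ (fun x hx => by
    rw [map_mul, MulChar.map_nonunit _ hx]; simp)]
  -- substitute `z = s / x`
  refine Fintype.sum_equiv ((Equiv.inv (ZMod q)ˣ).trans (Equiv.mulLeft s)) _ _ fun x => ?_
  simp only [Equiv.trans_apply, Equiv.inv_apply, Equiv.coe_mulLeft, Units.val_mul, ← hs]
  have b1 : (r : ZMod q) - m₂ * (s * (x⁻¹ : (ZMod q)ˣ)) =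
      (x⁻¹ : (ZMod q)ˣ) * (r * x - m₂ * s) := by
    linear_combination (-(r : ZMod q)) * x.inv_mul
  have b2 : (m₃ : ZMod q) * (s - m₂ * (s * (x⁻¹ : (ZMod q)ˣ))) =
      m₃ * (x - m₂) * ((s * x⁻¹ : (ZMod q)ˣ) : ZMod q) := by
    push_cast
    linear_combination (-(m₃ : ZMod q) * s) * x.mul_inv
  have b3 : (m₃ : ZMod q) * (u * (x - m₂)) = m₃ * (x - m₂) * u := by ring
  rw [b1, b2, b3, RR_mul_unit, RR_mul_unit]
  have hx : χ x = χ⁻¹ (x⁻¹ : (ZMod q)ˣ) := by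
    rw [MulChar.inv_apply, Ring.inverse_unit, inv_inv]
  have hu := char_mul_inv χ u.isUnit
  rw [map_mul, map_mul, map_mul, map_mul, hx]
  linear_combination (χ⁻¹ (x⁻¹ : (ZMod q)ˣ) * χ⁻¹ (r * x - m₂ * s) * χ s *
    RR ((m₃ : ZMod q) * ((x : ZMod q) - (m₂ : ZMod q)))) * (χ u * χ⁻¹ u + 1) * hu

lemma not_isUnit_nilpotent {p : ℕ} [Fact p.Prime] {k : ℕ} (hk : 1 ≤ k) {a : ZMod (p ^ k)}
    (ha : ¬ IsUnit a) : IsNilpotent a := by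
  have hp : p.Prime := Fact.out
  have hz : ((a.val : ℕ) : ZMod (p ^ k)) = a := by simp
  rw [← hz, ZMod.isUnit_iff_coprime, Nat.coprime_pow_right_iff hk, Nat.coprime_comm,
    hp.coprime_iff_not_dvd, not_not] at ha
  obtain ⟨c, hc⟩ := ha
  refine ⟨k, ?_⟩
  rw [← hz, hc, Nat.cast_mul, mul_pow, ← Nat.cast_pow, ZMod.natCast_self, zero_mul]

lemma unit_sub_nonunit {p : ℕ} [Fact p.Prime] {k : ℕ} (hk : 1 ≤ k) {a b : ZMod (p ^ k)}
    (ha : IsUnit a) (hb : ¬ IsUnit b) : IsUnit (a - b) := by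
  rw [sub_eq_add_neg]
  exact (not_isUnit_nilpotent hk hb).neg.isUnit_add_left_of_commute ha (Commute.all _ _)

lemma nonunit_sub_nonunit {p : ℕ} [Fact p.Prime] {k : ℕ} (hk : 1 ≤ k) {a b : ZMod (p ^ k)}
    (ha : ¬ IsUnit a) (hb : ¬ IsUnit b) : ¬ IsUnit (a - b) := by
  intro h
  apply ha
  have := unit_sub_nonunit hk h (b := -b) (by simpa using hb)
  simpa using this

lemma pow_cases {p : ℕ} [Fact p.Prime] {k : ℕ} (hk : 1 ≤ k) {m : ℤ}
    (h : ∃ a : ℕ, m = (p : ℤ) ^ a) :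
    (m : ZMod (p ^ k)) = 1 ∨ ¬ IsUnit (m : ZMod (p ^ k)) := by
  have hp : p.Prime := Fact.out
  obtain ⟨a, rfl⟩ := h
  rcases Nat.eq_zero_or_pos a with rfl | ha
  · left; simp
  · right
    have : (((p : ℤ) ^ a : ℤ) : ZMod (p ^ k)) = ((p ^ a : ℕ) : ZMod (p ^ k)) := by push_cast; rfl
    rw [this, ZMod.isUnit_iff_coprime, Nat.coprime_pow_left_iff ha, Nat.coprime_pow_right_iff hk,
      Nat.coprime_self]
    exact hp.ne_one

lemma prim_ne_one {q : ℕ} (hq : q ≠ 1) [NeZero q] {χ : DirichletCharacter ℂ q}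
    (hχ : χ.IsPrimitive) : χ ≠ 1 := by
  rintro rfl
  rw [DirichletCharacter.isPrimitive_def, DirichletCharacter.conductor_one] at hχ
  exact hq hχ.symm

/-- The common main term. -/
lemma main_term {q : ℕ} [NeZero q] {χ : DirichletCharacter ℂ q} (hχ : χ.IsPrimitive)
    (r m : ZMod q) :
    ∑ w : (ZMod q)ˣ, χ (r - (w : ZMod q)) * ∑ z : ZMod q,
      χ⁻¹ (r - z) * RR (m * (r - (w : ZMod q) - z)) =
    q * RR r * χ (-1) * (1 : DirichletCharacter ℂ q) m := by
  have h1 : ∀ w : (ZMod q)ˣ, ∑ z : ZMod q, χ⁻¹ (r - z) * RR (m * (r - (w : ZMod q) - z)) =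
      q * (1 : DirichletCharacter ℂ q) m * χ⁻¹ (w : ZMod q) := by
    intro w
    have := sum_char_RR hχ m (-(w : ZMod q))
    rw [neg_neg] at this
    rw [← this]
    refine Fintype.sum_equiv (Equiv.subLeft r) _ _ fun z => ?_
    simp only [Equiv.subLeft_apply]
    congr 3; ring
  simp only [h1]
  have h2 : ∑ w : (ZMod q)ˣ, χ (r - (w : ZMod q)) * χ⁻¹ (w : ZMod q) = χ (-1) * RR r := by
    rw [← sum_units_char hχ r, Finset.mul_sum]
    refine Fintype.sum_equiv (Equiv.inv (ZMod q)ˣ) _ _ fun w => ?_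
    simp only [Equiv.inv_apply]
    have hw : r - (w : ZMod q) = -1 * (1 - r * (w⁻¹ : (ZMod q)ˣ)) * w := by
      linear_combination (-r) * w.inv_mul
    rw [hw, map_mul, map_mul]
    linear_combination (χ (-1) * χ (1 - r * (w⁻¹ : (ZMod q)ˣ))) * char_mul_inv χ w.isUnit
  calc _ = (q * (1 : DirichletCharacter ℂ q) m) *
        ∑ w : (ZMod q)ˣ, χ (r - (w : ZMod q)) * χ⁻¹ (w : ZMod q) := by
        rw [Finset.mul_sum]
        exact Finset.sum_congr rfl fun w _ => by ring
    _ = _ := by rw [h2]; ring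

/-- For q = p^k (k ≥ 1), χ primitive modulo q, ψ₀ the trivial character modulo q,
and m₁, m₂, m₃, r powers of p:
Ĥ(ψ₀,χ,m₁,m₂,m₃,r) = ψ₀(r)·R_q(m₁)·R_q(m₂)·R_q(m₃) + q·R_q(r)·χ(−1)·ψ₀(m₁m₂m₃). -/
theorem Hhat_eval_psi_trivial (p : ℕ) [Fact p.Prime] (k : ℕ) (hk : 1 ≤ k)
    (χ : DirichletCharacter ℂ (p ^ k)) (hχ : χ.IsPrimitive)
    (m₁ m₂ m₃ r : ℤ)
    (h₁ : ∃ a : ℕ, m₁ = (p : ℤ) ^ a) (h₂ : ∃ a : ℕ, m₂ = (p : ℤ) ^ a)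
    (h₃ : ∃ a : ℕ, m₃ = (p : ℤ) ^ a) (hr : ∃ a : ℕ, r = (p : ℤ) ^ a) :
    Hhat (1 : DirichletCharacter ℂ (p ^ k)) χ m₁ m₂ m₃ r =
      (1 : DirichletCharacter ℂ (p ^ k)) ((r : ZMod (p ^ k))) *
          ramanujanSum (p ^ k) m₁ * ramanujanSum (p ^ k) m₂ * ramanujanSum (p ^ k) m₃ +
        ((p : ℂ) ^ k) * ramanujanSum (p ^ k) r * χ (-1) *
          (1 : DirichletCharacter ℂ (p ^ k)) (((m₁ * m₂ * m₃ : ℤ) : ZMod (p ^ k))) := by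
  have hp : p.Prime := Fact.out
  have hq : p ^ k ≠ 1 := (Nat.one_lt_pow (by omega) hp.one_lt).ne'
  have hχ' := prim_inv hχ
  have hqc : ((p : ℂ) ^ k) = ((p ^ k : ℕ) : ℂ) := by push_cast; rfl
  rw [Hhat_reduced, hqc]
  simp only [ramanujanSum_eq]
  have c₁ := pow_cases hk h₁
  have c₂ := pow_cases hk h₂
  have cr := pow_cases hk hr
  simp only [Int.cast_mul]
  generalize (m₁ : ZMod (p ^ k)) = a at *
  generalize (m₂ : ZMod (p ^ k)) = b at *
  generalize (m₃ : ZMod (p ^ k)) = c at *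
  generalize (r : ZMod (p ^ k)) = r at *
  have hnu : ∀ {x : ZMod (p ^ k)} (w : (ZMod (p ^ k))ˣ), ¬ IsUnit x →
      ¬ IsUnit (x * (w : ZMod (p ^ k))) := fun w hx => by simpa using hx
  rcases cr with rfl | hr'
  · rw [MulChar.one_apply isUnit_one, one_mul]
    by_cases hab : IsUnit a ∧ IsUnit b
    · obtain rfl : a = 1 := c₁.resolve_right (not_not.mpr hab.1)
      obtain rfl : b = 1 := c₂.resolve_right (not_not.mpr hab.2)
      simp only [one_mul]
      rw [← main_term hχ 1 c]
      nth_rewrite 1 [← sum_units_char hχ 1]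
      rw [Finset.sum_mul, Finset.sum_mul, ← Finset.sum_add_distrib]
      refine Finset.sum_congr rfl fun w _ => ?_
      simp only [one_mul]
      by_cases hw : IsUnit (1 - (w : ZMod (p ^ k)))
      swap
      · simp [MulChar.map_nonunit _ hw]
      simp only [mul_assoc]
      rw [← Finset.mul_sum, ← mul_add]
      congr 1
      have e0 : ∑ z : ZMod (p ^ k), χ⁻¹ (1 - z) = 0 := by
        rw [← MulChar.sum_eq_zero_of_ne_one (prim_ne_one hq hχ')]
        exact Fintype.sum_equiv (Equiv.subLeft 1) _ _ fun z => by simp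
      have e1 := sum_to_units (fun z : ZMod (p ^ k) => χ⁻¹ (1 - z) *
        (RR (c * (1 - (w : ZMod (p ^ k)) - z)) - RR c)) (fun z hz => by
          rw [RR_mul_isUnit c (unit_sub_nonunit hk hw hz)]; simp)
      simp only [mul_sub, Finset.sum_sub_distrib] at e1
      rw [← Finset.sum_mul, ← Finset.sum_mul, e0] at e1
      have e2 := sum_units_char hχ' (1 : ZMod (p ^ k))
      simp only [one_mul] at e2
      rw [e2] at e1
      simp only [mul_sub]
      linear_combination -e1
    · have h0 : (1 : DirichletCharacter ℂ (p ^ k)) (a * b * c) = 0 := by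
        apply MulChar.map_nonunit
        rw [IsUnit.mul_iff, IsUnit.mul_iff]
        tauto
      rw [h0, mul_zero, add_zero]
      nth_rewrite 1 [← sum_units_char hχ a]
      rw [← sum_units_char hχ' b, Finset.sum_mul_sum, Finset.sum_mul]
      refine Finset.sum_congr rfl fun w _ => ?_
      rw [Finset.sum_mul]
      refine Finset.sum_congr rfl fun z _ => ?_
      by_cases hw : IsUnit (1 - a * (w : ZMod (p ^ k)))
      swap
      · simp [MulChar.map_nonunit _ hw]
      by_cases hz : IsUnit (1 - b * (z : ZMod (p ^ k)))
      swap
      · simp [MulChar.map_nonunit _ hz]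
      rw [RR_mul_isUnit c]
      by_cases hb : IsUnit b
      · have ha : ¬ IsUnit a := fun h => hab ⟨h, hb⟩
        rw [sub_right_comm]
        exact unit_sub_nonunit hk hz (hnu w ha)
      · exact unit_sub_nonunit hk hw (hnu z hb)
  · rw [MulChar.map_nonunit _ hr']
    simp only [zero_mul, zero_add]
    by_cases ha : IsUnit a
    swap
    · have h0 : (1 : DirichletCharacter ℂ (p ^ k)) (a * b * c) = 0 := by
        apply MulChar.map_nonunit
        rw [IsUnit.mul_iff, IsUnit.mul_iff]
        tauto
      rw [h0, mul_zero]
      refine Finset.sum_eq_zero fun w _ => Finset.sum_eq_zero fun z _ => ?_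
      rw [MulChar.map_nonunit _ (nonunit_sub_nonunit hk hr' (hnu w ha))]
      simp
    by_cases hb : IsUnit b
    swap
    · have h0 : (1 : DirichletCharacter ℂ (p ^ k)) (a * b * c) = 0 := by
        apply MulChar.map_nonunit
        rw [IsUnit.mul_iff, IsUnit.mul_iff]
        tauto
      rw [h0, mul_zero]
      refine Finset.sum_eq_zero fun w _ => Finset.sum_eq_zero fun z _ => ?_
      rw [MulChar.map_nonunit χ⁻¹ (nonunit_sub_nonunit hk hr' (hnu z hb))]
      simp
    obtain rfl : a = 1 := c₁.resolve_right (not_not.mpr ha)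
    obtain rfl : b = 1 := c₂.resolve_right (not_not.mpr hb)
    simp only [one_mul]
    rw [← main_term hχ r c]
    refine Finset.sum_congr rfl fun w _ => ?_
    rw [sum_to_units _ (fun z hz => by
      rw [MulChar.map_nonunit χ⁻¹ (nonunit_sub_nonunit hk hr' hz), zero_mul]), Finset.mul_sum]
    exact Finset.sum_congr rfl fun z _ => by ring
end

section
/- Let p be a prime, q = p², let χ be a primitive Dirichlet character modulo p², let ψ be a Dirichlet character modulo p² of conductor exactly p, and let m₁, m₂, m₃, r be powers of p (nonnegative integer exponents) with gcd(m₁, r) = 1. Then Ĥ(ψ, χ, m₁, m₂, m₃, r) = 0 in each of the following cases: (i) m₁ = m₂ = m₃ = r = 1; (ii) m₁ = m₂ = m₃ = 1 and r = p^a with a ≥ 2; (iii) r = 1, p divides m₁·m₂·m₃, and (m₁, m₂, m₃) ≠ (p, p, p); (iv) p divides r and p divides m₁·m₂·m₃. -/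
set_option linter.unusedSectionVars false

namespace HV

variable {p : ℕ} [hp : Fact p.Prime]

theorem pp : (p : ZMod (p ^ 2)) * p = 0 := by
  have := ZMod.natCast_self (p ^ 2)
  push_cast at this
  rw [← this]; ring

theorem p_ne : (p : ZMod (p ^ 2)) ≠ 0 := by
  intro h
  rw [ZMod.natCast_eq_zero_iff] at h
  have h1 := Nat.le_of_dvd hp.out.pos h
  have := hp.out.one_lt
  nlinarith

theorem unit_or (x : ZMod (p ^ 2)) : IsUnit x ∨ ∃ y, x = (p : ZMod (p ^ 2)) * y := by
  by_cases h : p ∣ x.val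
  · right
    obtain ⟨k, hk⟩ := h
    refine ⟨(k : ZMod (p ^ 2)), ?_⟩
    rw [← ZMod.natCast_zmod_val x, hk]; push_cast; rfl
  · left
    rw [← ZMod.natCast_zmod_val x, ZMod.isUnit_iff_coprime]
    exact (((Nat.Prime.coprime_iff_not_dvd hp.out).2 h).pow_left 2).symm

theorem not_unit (y : ZMod (p ^ 2)) : ¬ IsUnit ((p : ZMod (p ^ 2)) * y) := by
  intro h
  apply p_ne (p := p)
  have h2 : (p : ZMod (p ^ 2)) * ((p : ZMod (p ^ 2)) * y) = 0 := by rw [← mul_assoc, pp, zero_mul]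
  exact (h.mul_left_eq_zero).1 h2

theorem unit_add {x : ZMod (p ^ 2)} (hx : IsUnit x) (y : ZMod (p ^ 2)) : IsUnit (x + (p : ZMod (p ^ 2)) * y) := by
  have h : (x + (p : ZMod (p ^ 2)) * y) * (x - (p : ZMod (p ^ 2)) * y) = x * x := by
    linear_combination (-y * y) * pp (p := p)
  exact isUnit_of_mul_isUnit_left (h ▸ hx.mul hx)

theorem unit_add_iff {x : ZMod (p ^ 2)} (y : ZMod (p ^ 2)) : IsUnit (x + (p : ZMod (p ^ 2)) * y) ↔ IsUnit x := by
  refine ⟨fun h => ?_, fun h => unit_add h y⟩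
  have := unit_add h (-y)
  simpa [mul_neg] using this

theorem mul_inv {x : ZMod (p ^ 2)} (hx : IsUnit x) : x * x⁻¹ = 1 := ZMod.mul_inv_of_unit x hx

theorem shift_sum (F : ZMod (p ^ 2) → ℂ) (a : ZMod (p ^ 2)) (h : ∀ u, ∑ w, F (u + a * w) = 0) :
    ∑ u, F u = 0 := by
  have h1 : ∑ u, ∑ w, F (u + a * w) = 0 := Finset.sum_eq_zero fun u _ => h u
  rw [Finset.sum_comm] at h1
  have h2 : ∀ w : ZMod (p ^ 2), ∑ u, F (u + a * w) = ∑ u, F u := fun w =>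
    Equiv.sum_comp (Equiv.addRight (a * w)) F
  simp only [h2, Finset.sum_const, nsmul_eq_mul] at h1
  rcases mul_eq_zero.1 h1 with h3 | h3
  · simp [ZMod.card, hp.out.ne_zero] at h3
  · exact h3

section chi
variable (χ : DirichletCharacter ℂ (p ^ 2))

noncomputable def th (y : ZMod (p ^ 2)) : ℂ := χ (1 + (p : ZMod (p ^ 2)) * y)

theorem th_add (x y : ZMod (p ^ 2)) : th χ (x + y) = th χ x * th χ y := by
  unfold th
  rw [← map_mul]; congr 1
  linear_combination (-x * y) * pp (p := p)

theorem th_zero : th χ 0 = 1 := by simp [th]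

theorem chi_shift (x z : ZMod (p ^ 2)) : χ (x + (p : ZMod (p ^ 2)) * z) = χ x * th χ (x⁻¹ * z) := by
  by_cases hx : IsUnit x
  · unfold th
    rw [← map_mul]; congr 1
    linear_combination (-(p : ZMod (p ^ 2)) * z) * mul_inv hx
  · rw [χ.map_nonunit hx, χ.map_nonunit (mt (unit_add_iff z).1 hx), zero_mul]

theorem chi_conj {x : ZMod (p ^ 2)} (hx : IsUnit x) : χ x * (starRingEnd ℂ) (χ x) = 1 := by
  obtain ⟨u, rfl⟩ := hx
  rw [Complex.mul_conj, Complex.normSq_eq_norm_sq, χ.unit_norm_eq_one]; norm_num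

theorem th_conj (y : ZMod (p ^ 2)) : (starRingEnd ℂ) (th χ y) = th χ (-y) := by
  have h1 : th χ y * (starRingEnd ℂ) (th χ y) = 1 := chi_conj χ (unit_add isUnit_one y)
  have h2 : th χ y * th χ (-y) = 1 := by rw [← th_add]; simp [th_zero]
  have h0 : th χ y ≠ 0 := fun h => by simp [h] at h1
  exact mul_left_cancel₀ h0 (h1.trans h2.symm)

theorem conj_shift (x z : ZMod (p ^ 2)) :
    (starRingEnd ℂ) (χ (x + (p : ZMod (p ^ 2)) * z)) = (starRingEnd ℂ) (χ x) * th χ (-(x⁻¹ * z)) := by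
  rw [chi_shift, map_mul, th_conj]

theorem th_nontriv (hχ : χ.IsPrimitive) : ∃ y, th χ y ≠ 1 := by
  by_contra! h
  have hd : p ∣ p ^ 2 := Dvd.intro_left (p ^ 1) rfl
  have hf : χ.FactorsThrough p := by
    rw [DirichletCharacter.factorsThrough_iff_ker_unitsMap hd]
    intro u hu
    rw [MonoidHom.mem_ker] at hu ⊢
    have h1 : ((u : ZMod (p ^ 2)).cast : ZMod p) = 1 := by
      rw [← ZMod.unitsMap_val hd, hu]; rfl
    have h2 : ∃ y, (u : ZMod (p ^ 2)) = 1 + (p : ZMod (p ^ 2)) * y := by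
      have h3 : (((u : ZMod (p ^ 2)) - 1 : ZMod (p ^ 2)).cast : ZMod p) = 0 := by
        rw [ZMod.cast_sub hd, h1, ZMod.cast_one hd, sub_self]
      rcases unit_or ((u : ZMod (p ^ 2)) - 1) with h4 | ⟨y, hy⟩
      · have h5 := ZMod.isUnit_cast_of_dvd hd h4.unit
        rw [IsUnit.unit_spec, h3] at h5
        exact absurd h5 not_isUnit_zero
      · exact ⟨y, by rw [← hy]; ring⟩
    obtain ⟨y, hy⟩ := h2
    ext
    rw [MulChar.coe_toUnitHom, hy]
    simpa [th] using h y
  have h1 := DirichletCharacter.conductor_dvd_of_mem_conductorSet χ hf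
  rw [(DirichletCharacter.isPrimitive_def χ).1 hχ] at h1
  have h2 := Nat.le_of_dvd hp.out.pos h1
  have := hp.out.one_lt
  nlinarith

theorem th_sum (hχ : χ.IsPrimitive) {D : ZMod (p ^ 2)} (hD : IsUnit D) :
    ∑ w, th χ (D * w) = 0 := by
  obtain ⟨y, hy⟩ := th_nontriv χ hχ
  have h1 : ∑ w, th χ (D * (w + D⁻¹ * y)) = ∑ w, th χ (D * w) :=
    Equiv.sum_comp (Equiv.addRight (D⁻¹ * y)) (fun w => th χ (D * w))
  have h2 : ∀ w, th χ (D * (w + D⁻¹ * y)) = th χ (D * w) * th χ y := fun w => by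
    rw [← th_add]; congr 1; linear_combination y * mul_inv hD
  simp only [h2, ← Finset.sum_mul] at h1
  by_contra h0
  exact hy (mul_left_cancel₀ h0 (h1.trans (mul_one _).symm))

theorem vanish (hχ : χ.IsPrimitive) (F : ZMod (p ^ 2) → ℂ) (D : ZMod (p ^ 2) → ZMod (p ^ 2))
    (hF : ∀ u w, F (u + (p : ZMod (p ^ 2)) * w) = F u * th χ (D u * w)) (hD : ∀ u, F u ≠ 0 → IsUnit (D u)) :
    ∑ u, F u = 0 := by
  refine shift_sum F p fun u => ?_
  simp only [hF, ← Finset.mul_sum]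
  by_cases h : F u = 0
  · rw [h, zero_mul]
  · rw [th_sum χ hχ (hD u h), mul_zero]

noncomputable def A (m₁ m₂ r t u : ZMod (p ^ 2)) : ℂ :=
  χ (t + m₂ * u) * (starRingEnd ℂ) (χ (r * t + m₁ * m₂)) *
      (starRingEnd ℂ) (χ u) * χ (-m₁ + r * u)

theorem A_units {m₁ m₂ r t u : ZMod (p ^ 2)} (h : A χ m₁ m₂ r t u ≠ 0) :
    IsUnit (t + m₂ * u) ∧ IsUnit (r * t + m₁ * m₂) ∧ IsUnit u ∧ IsUnit (-m₁ + r * u) := by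
  unfold A at h
  refine ⟨?_, ?_, ?_, ?_⟩ <;> (by_contra h'; apply h; simp [χ.map_nonunit h'])

theorem A_u (m₁ m₂ r t u w : ZMod (p ^ 2)) : A χ m₁ m₂ r t (u + (p : ZMod (p ^ 2)) * w) = A χ m₁ m₂ r t u *
    th χ ((m₂ * (t + m₂ * u)⁻¹ - u⁻¹ + r * (-m₁ + r * u)⁻¹) * w) := by
  unfold A
  rw [show t + m₂ * (u + (p : ZMod (p ^ 2)) * w) = (t + m₂ * u) + (p : ZMod (p ^ 2)) * (m₂ * w) by ring,
    show -m₁ + r * (u + (p : ZMod (p ^ 2)) * w) = (-m₁ + r * u) + (p : ZMod (p ^ 2)) * (r * w) by ring,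
    conj_shift, chi_shift, chi_shift]
  rw [show (m₂ * (t + m₂ * u)⁻¹ - u⁻¹ + r * (-m₁ + r * u)⁻¹) * w =
    (t + m₂ * u)⁻¹ * (m₂ * w) + -(u⁻¹ * w) + (-m₁ + r * u)⁻¹ * (r * w) by ring, th_add, th_add]
  ring

theorem A_t (m₁ m₂ r t u w : ZMod (p ^ 2)) : A χ m₁ m₂ r (t + (p : ZMod (p ^ 2)) * w) u = A χ m₁ m₂ r t u *
    th χ (((t + m₂ * u)⁻¹ - r * (r * t + m₁ * m₂)⁻¹) * w) := by
  unfold A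
  rw [show t + (p : ZMod (p ^ 2)) * w + m₂ * u = (t + m₂ * u) + (p : ZMod (p ^ 2)) * w by ring,
    show r * (t + (p : ZMod (p ^ 2)) * w) + m₁ * m₂ = (r * t + m₁ * m₂) + (p : ZMod (p ^ 2)) * (r * w) by ring,
    chi_shift, conj_shift]
  rw [show ((t + m₂ * u)⁻¹ - r * (r * t + m₁ * m₂)⁻¹) * w =
    (t + m₂ * u)⁻¹ * w + -((r * t + m₁ * m₂)⁻¹ * (r * w)) by ring, th_add]
  ring

end chi

section psi
variable (ψ : DirichletCharacter ℂ (p ^ 2))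

noncomputable def G (m t : ZMod (p ^ 2)) : ℂ :=
  ∑ v : ZMod (p ^ 2), ZMod.stdAddChar (m * (v * t)) * (starRingEnd ℂ) (ψ v)

theorem psi_nontriv (hψ : ψ.conductor = p) : ∃ c : (ZMod (p ^ 2))ˣ, ψ c ≠ 1 := by
  apply (MulChar.ne_one_iff (χ := ψ)).1
  intro h
  rw [DirichletCharacter.eq_one_iff_conductor_eq_one, hψ] at h
  exact hp.out.one_lt.ne' h

theorem psi_shift (hψ : ψ.conductor = p) (v w : ZMod (p ^ 2)) : ψ (v + (p : ZMod (p ^ 2)) * w) = ψ v := by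
  by_cases hv : IsUnit v
  · have hf := ψ.factorsThrough_conductor
    rw [hψ] at hf
    have hv' := unit_add hv w
    have e1 := DirichletCharacter.changeLevel_eq_cast_of_dvd hf.χ₀ hf.dvd hv.unit
    have e2 := DirichletCharacter.changeLevel_eq_cast_of_dvd hf.χ₀ hf.dvd hv'.unit
    rw [← hf.eq_changeLevel, IsUnit.unit_spec] at e1 e2
    rw [e1, e2, ZMod.cast_add hf.dvd, ZMod.cast_mul hf.dvd, ZMod.cast_natCast hf.dvd]
    simp
  · rw [ψ.map_nonunit hv, ψ.map_nonunit (mt (unit_add_iff w).1 hv)]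

theorem G_scale (m t : ZMod (p ^ 2)) (c : (ZMod (p ^ 2))ˣ) : G ψ m ((c : ZMod (p ^ 2)) * t) = ψ (c : ZMod (p ^ 2)) * G ψ m t := by
  unfold G
  rw [← Equiv.sum_comp (Units.mulLeft c) (fun v => ZMod.stdAddChar (m * (v * t)) * (starRingEnd ℂ) (ψ v)),
    Finset.mul_sum]
  refine Finset.sum_congr rfl fun v _ => ?_
  simp only [Units.mulLeft_apply, map_mul]
  rw [show m * (v * ((c : ZMod (p ^ 2)) * t)) = m * ((c : ZMod (p ^ 2)) * v * t) by ring]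
  linear_combination (-(ZMod.stdAddChar (m * ((c : ZMod (p ^ 2)) * v * t)) * (starRingEnd ℂ) (ψ v))) *
    chi_conj ψ c.isUnit

theorem G_zero (hψ : ψ.conductor = p) {m t : ZMod (p ^ 2)} (h : m * t = 0) : G ψ m t = 0 := by
  obtain ⟨c, hc⟩ := psi_nontriv ψ hψ
  have h1 := G_scale ψ m t c
  have h2 : G ψ m ((c : ZMod (p ^ 2)) * t) = G ψ m t := by
    unfold G
    refine Finset.sum_congr rfl fun v _ => ?_
    rw [show m * (v * ((c : ZMod (p ^ 2)) * t)) = m * (v * t) by linear_combination (v * c - v) * h]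
  rw [h2] at h1
  by_contra h0
  exact hc (mul_right_cancel₀ h0 (h1.symm.trans (one_mul _).symm))

theorem G_p (hψ : ψ.conductor = p) {m t : ZMod (p ^ 2)} (h : (p : ZMod (p ^ 2)) * (m * t) ≠ 0) : G ψ m t = 0 := by
  unfold G
  refine shift_sum _ p fun v => ?_
  have h1 : ∀ w, ZMod.stdAddChar (m * ((v + (p : ZMod (p ^ 2)) * w) * t)) * (starRingEnd ℂ) (ψ (v + (p : ZMod (p ^ 2)) * w)) =
      ZMod.stdAddChar (m * (v * t)) * (starRingEnd ℂ) (ψ v) *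
        ZMod.stdAddChar (w * ((p : ZMod (p ^ 2)) * (m * t))) := fun w => by
    rw [psi_shift ψ hψ, show m * ((v + (p : ZMod (p ^ 2)) * w) * t) = m * (v * t) + w * ((p : ZMod (p ^ 2)) * (m * t)) by ring,
      AddChar.map_add_eq_mul]
    ring
  simp only [h1, ← Finset.mul_sum]
  rw [AddChar.sum_mulShift _ (ZMod.isPrimitive_stdAddChar _), if_neg h]
  simp

theorem G_pshift (t w : ZMod (p ^ 2)) : G ψ p (t + (p : ZMod (p ^ 2)) * w) = G ψ p t := by
  unfold G
  refine Finset.sum_congr rfl fun v _ => ?_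
  rw [show (p : ZMod (p ^ 2)) * (v * (t + (p : ZMod (p ^ 2)) * w)) = (p : ZMod (p ^ 2)) * (v * t) by linear_combination (v * w) * pp (p := p)]

end psi

variable (ψ χ : DirichletCharacter ℂ (p ^ 2))

theorem Hhat_eq (m₁ m₂ m₃ r : ℤ) : Hhat ψ χ m₁ m₂ m₃ r =
    ∑ t : ZMod (p ^ 2), ∑ u : ZMod (p ^ 2), A χ m₁ m₂ r t u * G ψ m₃ t := by
  unfold Hhat A G
  refine Finset.sum_congr rfl fun t _ => Finset.sum_congr rfl fun u _ => ?_
  rw [Finset.mul_sum]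
  refine Finset.sum_congr rfl fun v _ => ?_
  have : eN (p ^ 2) (m₃ * (((v * t)).val : ℤ)) = ZMod.stdAddChar ((m₃ : ZMod (p ^ 2)) * (v * t)) := by
    unfold eN
    rw [← ZMod.stdAddChar_coe]
    push_cast
    rw [ZMod.natCast_zmod_val]
  rw [this]; push_cast; ring

noncomputable def H (m₁ m₂ m₃ r : ZMod (p ^ 2)) : ℂ :=
  ∑ t : ZMod (p ^ 2), ∑ u : ZMod (p ^ 2), A χ m₁ m₂ r t u * G ψ m₃ t

theorem H_u (hχ : χ.IsPrimitive) (m₁ m₂ m₃ r : ZMod (p ^ 2))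
    (h : ∀ t u, A χ m₁ m₂ r t u ≠ 0 → G ψ m₃ t ≠ 0 →
      IsUnit (m₂ * (t + m₂ * u)⁻¹ - u⁻¹ + r * (-m₁ + r * u)⁻¹)) : H ψ χ m₁ m₂ m₃ r = 0 := by
  unfold H
  refine Finset.sum_eq_zero fun t _ => ?_
  refine vanish χ hχ _ (fun u => m₂ * (t + m₂ * u)⁻¹ - u⁻¹ + r * (-m₁ + r * u)⁻¹) ?_ ?_
  · intro u w
    rw [A_u]; ring
  · intro u hu
    exact h t u (left_ne_zero_of_mul hu) (right_ne_zero_of_mul hu)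

theorem H_t (hχ : χ.IsPrimitive) (m₁ m₂ r : ZMod (p ^ 2))
    (h : ∀ t u, A χ m₁ m₂ r t u ≠ 0 → G ψ p t ≠ 0 →
      IsUnit ((t + m₂ * u)⁻¹ - r * (r * t + m₁ * m₂)⁻¹)) : H ψ χ m₁ m₂ p r = 0 := by
  unfold H
  rw [Finset.sum_comm]
  refine Finset.sum_eq_zero fun u _ => ?_
  refine vanish χ hχ _ (fun t => (t + m₂ * u)⁻¹ - r * (r * t + m₁ * m₂)⁻¹) ?_ ?_
  · intro t w
    rw [A_t, G_pshift]; ring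
  · intro t hu
    exact h t u (left_ne_zero_of_mul hu) (right_ne_zero_of_mul hu)

theorem H_s (hψ : ψ.conductor = p) (m₁ m₂ m₃ r : ZMod (p ^ 2))
    (h : ∀ c : (ZMod (p ^ 2))ˣ, ∃ d : (ZMod (p ^ 2))ˣ, ∀ t u,
      A χ m₁ m₂ r ((c : ZMod (p ^ 2)) * t) ((d : ZMod (p ^ 2)) * u) = A χ m₁ m₂ r t u) : H ψ χ m₁ m₂ m₃ r = 0 := by
  obtain ⟨c, hc⟩ := psi_nontriv ψ hψ
  obtain ⟨d, hd⟩ := h c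
  have h1 : H ψ χ m₁ m₂ m₃ r = ψ (c : ZMod (p ^ 2)) * H ψ χ m₁ m₂ m₃ r := by
    conv_lhs => unfold H
    rw [← Equiv.sum_comp (Units.mulLeft c), H, Finset.mul_sum]
    refine Finset.sum_congr rfl fun t _ => ?_
    rw [← Equiv.sum_comp (Units.mulLeft d), Finset.mul_sum]
    refine Finset.sum_congr rfl fun u _ => ?_
    simp only [Units.mulLeft_apply]
    rw [hd, G_scale]; ring
  by_contra h0
  exact hc (mul_right_cancel₀ h0 (h1.symm.trans (one_mul _).symm))

theorem H_r0 (hψ : ψ.conductor = p) (m₁ m₂ m₃ : ZMod (p ^ 2)) : H ψ χ m₁ m₂ m₃ 0 = 0 := by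
  refine H_s ψ χ hψ _ _ _ _ fun c => ⟨c, fun t u => ?_⟩
  unfold A
  rw [show (c : ZMod (p ^ 2)) * t + m₂ * ((c : ZMod (p ^ 2)) * u) = (c : ZMod (p ^ 2)) * (t + m₂ * u) by ring]
  simp only [map_mul, zero_mul]
  linear_combination (χ (t + m₂ * u) * (starRingEnd ℂ) (χ (0 + m₁ * m₂)) *
      (starRingEnd ℂ) (χ u) * χ (-m₁ + 0)) * chi_conj χ c.isUnit

theorem H_m1 (hψ : ψ.conductor = p) (m₂ m₃ : ZMod (p ^ 2)) : H ψ χ 0 m₂ m₃ 1 = 0 := by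
  refine H_s ψ χ hψ _ _ _ _ fun c => ⟨c, fun t u => ?_⟩
  unfold A
  rw [show (c : ZMod (p ^ 2)) * t + m₂ * ((c : ZMod (p ^ 2)) * u) = (c : ZMod (p ^ 2)) * (t + m₂ * u) by ring]
  simp only [map_mul, zero_mul, neg_zero, zero_add, add_zero, one_mul]
  linear_combination (χ (t + m₂ * u) * (starRingEnd ℂ) (χ t) *
      (starRingEnd ℂ) (χ u) * χ u) * (χ (c : ZMod (p ^ 2)) * (starRingEnd ℂ) (χ c) + 1) * chi_conj χ c.isUnit

theorem H_m2 (hψ : ψ.conductor = p) (m₁ m₃ : ZMod (p ^ 2)) : H ψ χ m₁ 0 m₃ 1 = 0 := by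
  refine H_s ψ χ hψ _ _ _ _ fun c => ⟨1, fun t u => ?_⟩
  unfold A
  simp only [map_mul, zero_mul, mul_zero, add_zero, one_mul, Units.val_one]
  linear_combination (χ t * (starRingEnd ℂ) (χ t) *
      (starRingEnd ℂ) (χ u) * χ (-m₁ + u)) * chi_conj χ c.isUnit

/-- If `m₃ = 1` the support condition is `p ∣ t`. -/
theorem G_one (hψ : ψ.conductor = p) {t : ZMod (p ^ 2)} (h : G ψ 1 t ≠ 0) : ∃ y, t = (p : ZMod (p ^ 2)) * y := by
  refine (unit_or t).resolve_left fun ht => h (G_p ψ hψ ?_)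
  rw [one_mul]
  exact fun h0 => p_ne (p := p) ((ht.mul_left_eq_zero).1 h0)

theorem G_pp (hψ : ψ.conductor = p) {t : ZMod (p ^ 2)} (h : G ψ p t ≠ 0) : IsUnit t := by
  refine (unit_or t).resolve_right ?_
  rintro ⟨y, rfl⟩
  exact h (G_zero ψ hψ (by rw [← mul_assoc, pp, zero_mul]))

theorem unit_of_eq {D e x y : ZMod (p ^ 2)} (hx : IsUnit x) (h : D * e = x + (p : ZMod (p ^ 2)) * y) : IsUnit D :=
  isUnit_of_mul_isUnit_left (h ▸ unit_add hx y)

theorem H_m3_zero (hψ : ψ.conductor = p) (m₁ m₂ r : ZMod (p ^ 2)) : H ψ χ m₁ m₂ 0 r = 0 := by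
  simp [H, G_zero ψ hψ (zero_mul _)]

theorem H_m3_one_m2 (hχ : χ.IsPrimitive) (hψ : ψ.conductor = p) (m₁ k r : ZMod (p ^ 2)) :
    H ψ χ m₁ ((p : ZMod (p ^ 2)) * k) 1 r = 0 := by
  refine H_u ψ χ hχ _ _ _ _ fun t u hA hG => ?_
  obtain ⟨y, rfl⟩ := G_one ψ hψ hG
  have := (A_units χ hA).1
  rw [show (p : ZMod (p ^ 2)) * y + (p : ZMod (p ^ 2)) * k * u = (p : ZMod (p ^ 2)) * (y + k * u) by ring] at this
  exact absurd this (not_unit _)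

theorem H_m3_one_m1 (hχ : χ.IsPrimitive) (hψ : ψ.conductor = p) (k m₂ r : ZMod (p ^ 2)) :
    H ψ χ ((p : ZMod (p ^ 2)) * k) m₂ 1 r = 0 := by
  refine H_u ψ χ hχ _ _ _ _ fun t u hA hG => ?_
  obtain ⟨y, rfl⟩ := G_one ψ hψ hG
  have := (A_units χ hA).2.1
  rw [show r * ((p : ZMod (p ^ 2)) * y) + (p : ZMod (p ^ 2)) * k * m₂ = (p : ZMod (p ^ 2)) * (r * y + k * m₂) by ring] at this
  exact absurd this (not_unit _)

theorem H_i (hχ : χ.IsPrimitive) (hψ : ψ.conductor = p) : H ψ χ 1 1 1 1 = 0 := by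
  refine H_u ψ χ hχ _ _ _ _ fun t u hA hG => ?_
  obtain ⟨y, rfl⟩ := G_one ψ hψ hG
  obtain ⟨hX, -, hu, hY⟩ := A_units χ hA
  have eX := mul_inv hX
  have eu := mul_inv hu
  have eY := mul_inv hY
  set X := ((p : ZMod (p ^ 2)) * y + 1 * u : ZMod (p ^ 2)) with hXd
  set Y := (-1 + 1 * u : ZMod (p ^ 2)) with hYd
  refine unit_of_eq (e := X * u * Y) (y := y) (hu.mul hu) ?_
  have : (1 * X⁻¹ - u⁻¹ + 1 * Y⁻¹) * (X * u * Y) = u * Y - X * Y + X * u := by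
    linear_combination (u * Y) * eX - X * Y * eu + X * u * eY
  rw [this, hXd, hYd]; ring

theorem H_p_m2 (hχ : χ.IsPrimitive) (hψ : ψ.conductor = p) (m₁ : ZMod (p ^ 2)) :
    H ψ χ m₁ 1 p 1 = 0 := by
  refine H_t ψ χ hχ _ _ _ fun t u hA hG => ?_
  obtain ⟨hX, hZ, hu, hY⟩ := A_units χ hA
  have eX := mul_inv hX
  have eZ := mul_inv hZ
  set X := (t + 1 * u : ZMod (p ^ 2)) with hXd
  set Z := (1 * t + m₁ * 1 : ZMod (p ^ 2)) with hZd
  refine unit_of_eq (e := X * Z) (y := 0) hY.neg ?_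
  have : (X⁻¹ - 1 * Z⁻¹) * (X * Z) = Z - X := by
    linear_combination Z * eX - X * eZ
  rw [this, hXd, hZd]; ring

theorem H_p_m1 (hχ : χ.IsPrimitive) (k : ZMod (p ^ 2)) :
    H ψ χ 1 ((p : ZMod (p ^ 2)) * k) p 1 = 0 := by
  refine H_u ψ χ hχ _ _ _ _ fun t u hA hG => ?_
  obtain ⟨hX, -, hu, hY⟩ := A_units χ hA
  have eX := mul_inv hX
  have eu := mul_inv hu
  have eY := mul_inv hY
  have hX' := hX
  set X := (t + (p : ZMod (p ^ 2)) * k * u : ZMod (p ^ 2)) with hXd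
  set Y := (-1 + 1 * u : ZMod (p ^ 2)) with hYd
  refine unit_of_eq (e := X * u * Y) (y := k * u * Y) hX ?_
  have : ((p : ZMod (p ^ 2)) * k * X⁻¹ - u⁻¹ + 1 * Y⁻¹) * (X * u * Y) = (p : ZMod (p ^ 2)) * k * u * Y - X * Y + X * u := by
    linear_combination ((p : ZMod (p ^ 2)) * k * u * Y) * eX - X * Y * eu + X * u * eY
  rw [this]
  linear_combination (-X) * hYd

theorem H_p_r (hχ : χ.IsPrimitive) (hψ : ψ.conductor = p) (k : ZMod (p ^ 2)) :
    H ψ χ 1 1 p ((p : ZMod (p ^ 2)) * k) = 0 := by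
  refine H_u ψ χ hχ _ _ _ _ fun t u hA hG => ?_
  have ht := G_pp ψ hψ hG
  obtain ⟨hX, -, hu, hY⟩ := A_units χ hA
  have eX := mul_inv hX
  have eu := mul_inv hu
  have eY := mul_inv hY
  set X := (t + 1 * u : ZMod (p ^ 2)) with hXd
  set Y := (-1 + (p : ZMod (p ^ 2)) * k * u : ZMod (p ^ 2)) with hYd
  refine unit_of_eq (e := X * u * Y) (y := k * X * u) (ht.mul hY).neg ?_
  have : (1 * X⁻¹ - u⁻¹ + (p : ZMod (p ^ 2)) * k * Y⁻¹) * (X * u * Y) = u * Y - X * Y + (p : ZMod (p ^ 2)) * k * X * u := by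
    linear_combination (u * Y) * eX - X * Y * eu + (p : ZMod (p ^ 2)) * k * X * u * eY
  rw [this]
  linear_combination (-Y) * hXd

theorem H_p_r_m2 (hχ : χ.IsPrimitive) (m₁ l k : ZMod (p ^ 2)) :
    H ψ χ m₁ ((p : ZMod (p ^ 2)) * l) p ((p : ZMod (p ^ 2)) * k) = 0 := by
  refine H_u ψ χ hχ _ _ _ _ fun t u hA hG => ?_
  have := (A_units χ hA).2.1
  rw [show (p : ZMod (p ^ 2)) * k * t + m₁ * ((p : ZMod (p ^ 2)) * l) = (p : ZMod (p ^ 2)) * (k * t + m₁ * l) by ring] at this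
  exact absurd this (not_unit _)

/-- A power of `p` is `1`, `p`, or vanishes modulo `p²`. -/
theorem pow_cases {m : ℤ} (h : ∃ a : ℕ, m = (p : ℤ) ^ a) :
    m = 1 ∨ ((m = p ∨ (m : ZMod (p ^ 2)) = 0) ∧ (p : ℤ) ∣ m ∧ ∃ k, (m : ZMod (p ^ 2)) = (p : ZMod (p ^ 2)) * k) := by
  obtain ⟨a, rfl⟩ := h
  rcases a with _ | _ | a
  · left; simp
  · right; exact ⟨Or.inl (by simp), by simp, 1, by simp⟩
  · right
    have h0 : (((p : ℤ) ^ (a + 1 + 1) : ℤ) : ZMod (p ^ 2)) = 0 := by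
      push_cast
      linear_combination ((p : ZMod (p ^ 2)) ^ a) * pp (p := p)
    exact ⟨Or.inr h0, dvd_pow_self _ (by omega), 0, by rw [h0, mul_zero]⟩

theorem not_dvd_one : ¬ (p : ℤ) ∣ 1 := by
  intro h
  have := Int.natCast_dvd_natCast.1 (by exact_mod_cast h : ((p : ℕ) : ℤ) ∣ ((1 : ℕ) : ℤ))
  exact hp.out.one_lt.ne' (Nat.dvd_one.1 this)

end HV

/-- For p prime, χ primitive modulo p², ψ modulo p² of conductor exactly p, and
m₁, m₂, m₃, r powers of p with gcd(m₁,r) = 1, Ĥ(ψ,χ,m₁,m₂,m₃,r) = 0 in each of the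
following cases: (i) m₁ = m₂ = m₃ = r = 1; (ii) m₁ = m₂ = m₃ = 1 and r = p^a, a ≥ 2;
(iii) r = 1, p ∣ m₁m₂m₃ and (m₁,m₂,m₃) ≠ (p,p,p); (iv) p ∣ r and p ∣ m₁m₂m₃. -/
theorem Hhat_vanishing_intermediate (p : ℕ) [Fact p.Prime]
    (χ : DirichletCharacter ℂ (p ^ 2)) (hχ : χ.IsPrimitive)
    (ψ : DirichletCharacter ℂ (p ^ 2)) (hψ : ψ.conductor = p)
    (m₁ m₂ m₃ r : ℤ)
    (h₁ : ∃ a : ℕ, m₁ = (p : ℤ) ^ a) (h₂ : ∃ a : ℕ, m₂ = (p : ℤ) ^ a)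
    (h₃ : ∃ a : ℕ, m₃ = (p : ℤ) ^ a) (hr : ∃ a : ℕ, r = (p : ℤ) ^ a)
    (hcop : Int.gcd m₁ r = 1) :
    ((m₁ = 1 ∧ m₂ = 1 ∧ m₃ = 1 ∧ r = 1) → Hhat ψ χ m₁ m₂ m₃ r = 0) ∧
    ((m₁ = 1 ∧ m₂ = 1 ∧ m₃ = 1 ∧ (∃ a : ℕ, 2 ≤ a ∧ r = (p : ℤ) ^ a)) →
        Hhat ψ χ m₁ m₂ m₃ r = 0) ∧
    ((r = 1 ∧ (p : ℤ) ∣ m₁ * m₂ * m₃ ∧ ¬(m₁ = (p : ℤ) ∧ m₂ = (p : ℤ) ∧ m₃ = (p : ℤ))) →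
        Hhat ψ χ m₁ m₂ m₃ r = 0) ∧
    (((p : ℤ) ∣ r ∧ (p : ℤ) ∣ m₁ * m₂ * m₃) → Hhat ψ χ m₁ m₂ m₃ r = 0) := by
  rw [HV.Hhat_eq]
  change (_ → HV.H ψ χ m₁ m₂ m₃ r = 0) ∧ (_ → HV.H ψ χ m₁ m₂ m₃ r = 0) ∧
    (_ → HV.H ψ χ m₁ m₂ m₃ r = 0) ∧ (_ → HV.H ψ χ m₁ m₂ m₃ r = 0)
  refine ⟨?_, ?_, ?_, ?_⟩
  · rintro ⟨rfl, rfl, rfl, rfl⟩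
    simpa using HV.H_i ψ χ hχ hψ
  · rintro ⟨-, -, -, a, ha, rfl⟩
    have h0 : (((p : ℤ) ^ a : ℤ) : ZMod (p ^ 2)) = 0 := by
      obtain ⟨b, rfl⟩ := Nat.exists_eq_add_of_le ha
      push_cast
      linear_combination ((p : ZMod (p ^ 2)) ^ b) * HV.pp (p := p)
    rw [h0]
    exact HV.H_r0 ψ χ hψ _ _ _
  · rintro ⟨rfl, hd, hne⟩
    rw [Int.cast_one]
    rcases HV.pow_cases h₃ with rfl | ⟨rfl | h3, -, -⟩
    · rw [Int.cast_one]
      rcases HV.pow_cases h₂ with rfl | ⟨-, -, k, hk⟩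
      · rcases HV.pow_cases h₁ with rfl | ⟨-, -, k, hk⟩
        · exact absurd (by simpa using hd) (HV.not_dvd_one (p := p))
        · rw [hk]; exact HV.H_m3_one_m1 ψ χ hχ hψ _ _ _
      · rw [hk]; exact HV.H_m3_one_m2 ψ χ hχ hψ _ _ _
    · rw [Int.cast_natCast]
      rcases HV.pow_cases h₂ with rfl | ⟨h2, -, k, hk⟩
      · rw [Int.cast_one]; exact HV.H_p_m2 ψ χ hχ hψ _
      · rcases HV.pow_cases h₁ with rfl | ⟨h1, -, -⟩
        · rw [hk, Int.cast_one]; exact HV.H_p_m1 ψ χ hχ _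
        · rcases h1 with h1 | h1
          · rcases h2 with h2 | h2
            · exact absurd ⟨h1, h2, rfl⟩ hne
            · rw [h2]; exact HV.H_m2 ψ χ hψ _ _
          · rw [h1]; exact HV.H_m1 ψ χ hψ _ _
    · rw [h3]; exact HV.H_m3_zero ψ χ hψ _ _ _
  · rintro ⟨hpr, hd⟩
    have hm1 : m₁ = 1 := by
      rcases HV.pow_cases h₁ with h | ⟨-, h, -⟩
      · exact h
      · have := Int.dvd_coe_gcd h hpr
        rw [hcop] at this
        exact absurd (by simpa using this) (HV.not_dvd_one (p := p))
    subst hm1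
    obtain ⟨k, hk⟩ : ∃ k, (r : ZMod (p ^ 2)) = p * k := by
      obtain ⟨s, rfl⟩ := hpr
      exact ⟨s, by push_cast; rfl⟩
    rw [Int.cast_one]
    rcases HV.pow_cases h₃ with rfl | ⟨rfl | h3, -, -⟩
    · rw [Int.cast_one]
      rcases HV.pow_cases h₂ with rfl | ⟨-, -, l, hl⟩
      · exact absurd (by simpa using hd) (HV.not_dvd_one (p := p))
      · rw [hl]; exact HV.H_m3_one_m2 ψ χ hχ hψ _ _ _
    · rw [Int.cast_natCast, hk]
      rcases HV.pow_cases h₂ with rfl | ⟨-, -, l, hl⟩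
      · rw [Int.cast_one]; exact HV.H_p_r ψ χ hχ hψ _
      · rw [hl]; exact HV.H_p_r_m2 ψ χ hχ _ _ _
    · rw [h3]; exact HV.H_m3_zero ψ χ hψ _ _ _
end
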